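/- Suppose 0 < γ' ≤ γ_n ≤ γ < 1 for all n ≥ 0, let {(x_n, y_n)}_{n=0}^∞ be a solution of the system with positive initial conditions, and let {k_i}_{i=1}^∞ be a sequence of indices such that {x_{k_i}} is bounded and lim_{i→∞} w_{k_i} = M ∈ (0,∞). Then the iterated limit lim_{i→∞} lim_{n→∞} φ(k_i, n) exists and equals M. -/

import Mathlib

open Filter Topology

/-- The coefficient sequence extended to `ℤ` by the convention `γ₋₁ := γ₀`. -/
noncomputable def gext (γ : ℕ → ℝ) : ℤ → ℝ := fun j => if j < 0 then γ 0 else γ j.toNat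

/-- `μ(i,1) = 1` and `μ(i,k) = ∏_{j=i-1}^{i+k-3} γ_j` for `k ≥ 2`. -/
noncomputable def mu (γ : ℕ → ℝ) (i k : ℕ) : ℝ :=
  ∏ t ∈ Finset.range (k - 1), gext γ ((i : ℤ) - 1 + (t : ℤ))

/-- `φ(i,n) = ∑_{k=1}^n μ(i,k) x_{i+k}`. -/
noncomputable def phi (γ x : ℕ → ℝ) (i n : ℕ) : ℝ :=
  ∑ k ∈ Finset.Icc 1 n, mu γ i k * x (i + k)

/-- `w_n = (γ_{n-1} + x_n)/y_n`, where `γ₋₁ := γ₀` (Nat subtraction). -/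
noncomputable def wseq (γ x y : ℕ → ℝ) (n : ℕ) : ℝ := (γ (n - 1) + x n) / y n

theorem gext_sub_one_add (γ : ℕ → ℝ) (i t : ℕ) :
    gext γ ((i : ℤ) - 1 + (t : ℤ)) = γ (i + t - 1) := by
  unfold gext
  split_ifs with h
  · congr 1
    omega
  · congr 1
    omega

theorem mu_succ_succ (γ : ℕ → ℝ) (i n : ℕ) :
    mu γ i (n + 2) = mu γ i (n + 1) * γ (i + n - 1) := by
  simp [mu, Finset.prod_range_succ, gext_sub_one_add]

theorem mu_pos {γ : ℕ → ℝ} (hγpos : ∀ n, 0 < γ n) (i n : ℕ) : 0 < mu γ i n :=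
  Finset.prod_pos fun t _ => by
    rw [gext_sub_one_add]
    exact hγpos _

theorem solution_pos {γ x y : ℕ → ℝ} (hγpos : ∀ n, 0 < γ n) (hx0 : 0 < x 0) (hy0 : 0 < y 0)
    (hx : ∀ n, x (n + 1) = x n / y n) (hy : ∀ n, y (n + 1) = x n + γ n * y n) (n : ℕ) :
    0 < x n ∧ 0 < y n := by
  induction n with
  | zero => exact ⟨hx0, hy0⟩
  | succ n ih =>
    obtain ⟨hxn, hyn⟩ := ih
    have := hγpos n
    rw [hx, hy]
    exact ⟨by positivity, by positivity⟩

/-- The component `x` of a positive solution does not vanish at infinity: otherwise `y` would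
decay geometrically, and `x (n + 1) = x n / y n` would eventually be nondecreasing. -/
theorem not_tendsto_zero {γ x y : ℕ → ℝ} {g : ℝ} (hγhi : ∀ n, γ n ≤ g) (hg : g < 1)
    (hγpos : ∀ n, 0 < γ n) (hxpos : ∀ n, 0 < x n) (hypos : ∀ n, 0 < y n)
    (hx : ∀ n, x (n + 1) = x n / y n) (hy : ∀ n, y (n + 1) = x n + γ n * y n) :
    ¬ Tendsto x atTop (𝓝 0) := by
  intro hlim
  have hg0 : 0 < g := (hγpos 0).trans_le (hγhi 0)
  obtain ⟨N, hN⟩ := eventually_atTop.1 (hlim.eventually_lt_const (show 0 < (1 - g) / 2 by linarith))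
  have hdecay : ∀ n, y (N + n) ≤ ((1 + g) / 2) ^ n * y N := by
    intro n
    induction n with
    | zero => simp
    | succ n ih =>
      have hxy : x (N + n) = x (N + n + 1) * y (N + n) := by
        rw [hx, div_mul_cancel₀ _ (hypos _).ne']
      have hsmall := hN (N + n + 1) (by omega)
      calc y (N + (n + 1)) = (x (N + n + 1) + γ (N + n)) * y (N + n) := by
            rw [← add_assoc, hy, add_mul, ← hxy]
        _ ≤ (1 + g) / 2 * y (N + n) := by
            have := hγhi (N + n)
            exact mul_le_mul_of_nonneg_right (by linarith) (hypos _).le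
        _ ≤ (1 + g) / 2 * (((1 + g) / 2) ^ n * y N) := by gcongr
        _ = ((1 + g) / 2) ^ (n + 1) * y N := by ring
  have hpow : Tendsto (fun n : ℕ => ((1 + g) / 2) ^ n * y N) atTop (𝓝 0) := by
    simpa using (tendsto_pow_atTop_nhds_zero_of_lt_one (r := (1 + g) / 2)
      (by linarith) (by linarith)).mul_const (y N)
  obtain ⟨K, hK⟩ := eventually_atTop.1 (hpow.eventually_lt_const one_pos)
  have hmono : Monotone fun n => x (N + K + n) := by
    refine monotone_nat_of_le_succ fun n => ?_
    have hy1 : y (N + K + n) < 1 := by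
      rw [add_assoc]
      exact (hdecay _).trans_lt (hK _ (by omega))
    rw [← add_assoc, hx, le_div_iff₀ (hypos _)]
    exact mul_le_of_le_one_right (hxpos _).le hy1.le
  have hshift : Tendsto (fun n => x (N + K + n)) atTop (𝓝 0) := by
    simpa only [add_comm] using (tendsto_add_atTop_iff_nat (N + K)).2 hlim
  exact (hmono.ge_of_tendsto hshift 0).not_gt (hxpos _)

theorem wseq_succ {γ x y : ℕ → ℝ} (hγpos : ∀ n, 0 < γ n) (hxpos : ∀ n, 0 < x n)
    (hypos : ∀ n, 0 < y n) (hx : ∀ n, x (n + 1) = x n / y n)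
    (hy : ∀ n, y (n + 1) = x n + γ n * y n) (n : ℕ) :
    wseq γ x y (n + 1) = 1 / y n := by
  have h1 := hypos n
  have h2 : 0 < x n + γ n * y n := by
    have := hγpos n
    have := hxpos n
    positivity
  rw [wseq, hx, hy, Nat.add_sub_cancel, div_eq_div_iff h2.ne' h1.ne']
  field_simp
  ring

theorem phi_add_mu_mul_wseq {γ x y : ℕ → ℝ} (hγpos : ∀ n, 0 < γ n) (hxpos : ∀ n, 0 < x n)
    (hypos : ∀ n, 0 < y n) (hx : ∀ n, x (n + 1) = x n / y n)
    (hy : ∀ n, y (n + 1) = x n + γ n * y n) (i n : ℕ) :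
    phi γ x i n + mu γ i (n + 1) * wseq γ x y (i + n) = wseq γ x y i := by
  induction n with
  | zero => simp [phi, mu]
  | succ n ih =>
    have hw : wseq γ x y (i + n)
        = x (i + n + 1) + γ (i + n - 1) * wseq γ x y (i + n + 1) := by
      rw [wseq_succ hγpos hxpos hypos hx hy, hx, wseq]
      ring
    have hphi : phi γ x i (n + 1) = phi γ x i n + mu γ i (n + 1) * x (i + n + 1) :=
      Finset.sum_Icc_succ_top (by omega) _
    rw [← ih, hphi, mu_succ_succ, hw, ← add_assoc i n 1]
    ring

/-- The remainder in the expansion of `w_i` tends to `0`: it is positive and decreasing, and if its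
limit were positive then the ratio of consecutive terms would force `x` to tend to `0`. -/
theorem tendsto_mu_mul_wseq {γ x y : ℕ → ℝ} {g : ℝ} (hγhi : ∀ n, γ n ≤ g) (hg : g < 1)
    (hγpos : ∀ n, 0 < γ n) (hxpos : ∀ n, 0 < x n) (hypos : ∀ n, 0 < y n)
    (hx : ∀ n, x (n + 1) = x n / y n) (hy : ∀ n, y (n + 1) = x n + γ n * y n) (i : ℕ) :
    Tendsto (fun n => mu γ i (n + 1) * wseq γ x y (i + n)) atTop (𝓝 0) := by
  set R : ℕ → ℝ := fun n => mu γ i (n + 1) * wseq γ x y (i + n) with hR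
  have hRpos : ∀ n, 0 < R n := fun n =>
    mul_pos (mu_pos hγpos _ _) (div_pos (add_pos (hγpos _) (hxpos _)) (hypos _))
  have hRsucc : ∀ n, γ (i + n - 1) * R n = (γ (i + n - 1) + x (i + n)) * R (n + 1) := by
    intro n
    simp only [hR]
    rw [mu_succ_succ, ← add_assoc i n 1, wseq_succ hγpos hxpos hypos hx hy, wseq]
    ring
  have hanti : Antitone R := by
    refine antitone_nat_of_succ_le fun n => ?_
    have h1 := mul_pos (hxpos (i + n)) (hRpos (n + 1))
    exact le_of_mul_le_mul_left (by linarith [hRsucc n]) (hγpos (i + n - 1))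
  have hbdd : BddBelow (Set.range R) := ⟨0, by rintro _ ⟨n, rfl⟩; exact (hRpos n).le⟩
  have hlim := tendsto_atTop_ciInf hanti hbdd
  rcases (le_ciInf fun n => (hRpos n).le : 0 ≤ ⨅ n, R n).eq_or_lt with h0 | h0
  · rwa [← h0] at hlim
  refine absurd ?_ (not_tendsto_zero hγhi hg hγpos hxpos hypos hx hy)
  have hratio : Tendsto (fun n => R n / R (n + 1) - 1) atTop (𝓝 0) := by
    simpa [div_self h0.ne'] using
      (hlim.div ((tendsto_add_atTop_iff_nat 1).2 hlim) h0.ne').sub_const 1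
  rw [← tendsto_add_atTop_iff_nat i]
  refine squeeze_zero (fun n => (hxpos _).le) (fun n => ?_) hratio
  have h1 := hRpos (n + 1)
  have h2 := hanti (Nat.le_succ n)
  have h3 : γ (i + n - 1) ≤ 1 := (hγhi _).trans hg.le
  rw [add_comm n i, le_sub_iff_add_le, le_div_iff₀ h1]
  nlinarith [hRsucc n, mul_nonneg (sub_nonneg.2 h3) (sub_nonneg.2 h2)]

/-- Under the standing hypotheses, if `{x_{kᵢ}}` is bounded and `w_{kᵢ} → M ∈ (0,∞)`,
then the iterated limit `lim_{i→∞} lim_{n→∞} φ(kᵢ,n)` exists and equals `M`. -/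
theorem stmt5 (γ x y : ℕ → ℝ) (γ' g : ℝ)
    (hγ' : 0 < γ') (hγlo : ∀ n, γ' ≤ γ n) (hγhi : ∀ n, γ n ≤ g) (hg : g < 1)
    (hγpos : ∀ n, 0 < γ n)
    (hx0 : 0 < x 0) (hy0 : 0 < y 0)
    (hx : ∀ n, x (n + 1) = x n / y n)
    (hy : ∀ n, y (n + 1) = x n + γ n * y n)
    (k : ℕ → ℕ) (M : ℝ) (hM : 0 < M)
    (hkbdd : ∃ C : ℝ, ∀ i, x (k i) ≤ C)
    (hkw : Filter.Tendsto (fun i => wseq γ x y (k i)) Filter.atTop (nhds M)) :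
    ∃ L : ℕ → ℝ,
      (∀ i : ℕ, Filter.Tendsto (fun n => phi γ x (k i) n) Filter.atTop (nhds (L i))) ∧
      Filter.Tendsto L Filter.atTop (nhds M) := by
  have hpos := solution_pos hγpos hx0 hy0 hx hy
  have hxpos n := (hpos n).1
  have hypos n := (hpos n).2
  refine ⟨fun i => wseq γ x y (k i), fun i => ?_, hkw⟩
  have hrem := (tendsto_mu_mul_wseq hγhi hg hγpos hxpos hypos hx hy (k i)).const_sub
    (wseq γ x y (k i))
  rw [sub_zero] at hrem
  refine hrem.congr fun n => ?_
  rw [← phi_add_mu_mul_wseq hγpos hxpos hypos hx hy (k i) n, add_sub_cancel_right]
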